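/- arXiv:2111.08399 — 2 statements merged into one kernel-verified Lean document; each statement's English description precedes it below -/
import Mathlib

section
/- The 7-dimensional indecomposable 2-step nilpotent Lie algebra 27A, with basis e₁,…,e₇ and structure equations de⁶ = e^{12}, de⁷ = e^{14}+e^{35} (all other de^i = 0), does not admit a coclosed G2-structure: for every basis f¹,…,f⁷ of its dual space, the 4-form ∗φ = f^{1234}+f^{1256}+f^{1367}+f^{1457}+f^{2357}−f^{2467}+f^{3456} is not d-closed. -/
set_option synthInstance.maxHeartbeats 1000000
set_option maxHeartbeats 1000000

open ExteriorAlgebra Module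

noncomputable section

/-- The degree-`k` homogeneous component of the exterior algebra of `V`. -/
def degPart (V : Type*) [AddCommGroup V] [Module ℝ V] (k : ℕ) :
    Submodule ℝ (ExteriorAlgebra ℝ V) :=
  LinearMap.range (ExteriorAlgebra.ι ℝ : V →ₗ[ℝ] ExteriorAlgebra ℝ V) ^ k

/-- `c` is the interior product (contraction) with the vector `X : V`, acting on the exterior
algebra `Λ V*` of the dual of `V`: it is an odd antiderivation which on a 1-form `α` gives the
scalar `α(X)`. -/
def IsContraction {V : Type*} [AddCommGroup V] [Module ℝ V] (X : V)
    (c : ExteriorAlgebra ℝ (Dual ℝ V) →ₗ[ℝ] ExteriorAlgebra ℝ (Dual ℝ V)) : Prop :=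
  (∀ k, ∀ x ∈ degPart (Dual ℝ V) k, ∀ y,
      c (x * y) = c x * y + ((-1 : ℝ)) ^ k • (x * c y)) ∧
  (∀ α : Dual ℝ V, c (ExteriorAlgebra.ι ℝ α) = algebraMap ℝ _ (α X))

variable {g : Type*} [LieRing g] [LieAlgebra ℝ g]

/-- `d` is the Chevalley–Eilenberg differential of `g` on `Λ g*`, expressed with respect to a
basis `b` of `g`: it raises degree by one, is an odd derivation, and on 1-forms it is given by
`dα = -Σ_{i<j} α([b i, b j]) bⁱ ∧ bʲ` (which encodes `dα(x,y) = -α([x,y])`). -/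
def IsCEDifferential {n : ℕ} (b : Basis (Fin n) ℝ g)
    (d : ExteriorAlgebra ℝ (Dual ℝ g) →ₗ[ℝ] ExteriorAlgebra ℝ (Dual ℝ g)) : Prop :=
  (∀ k, ∀ x ∈ degPart (Dual ℝ g) k, d x ∈ degPart (Dual ℝ g) (k + 1)) ∧
  (∀ k, ∀ x ∈ degPart (Dual ℝ g) k, ∀ y,
      d (x * y) = d x * y + ((-1 : ℝ)) ^ k • (x * d y)) ∧
  (∀ α : Dual ℝ g, d (ExteriorAlgebra.ι ℝ α) =
    (-(2⁻¹ : ℝ)) • ∑ i, ∑ j, α ⁅b i, b j⁆ •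
      (ExteriorAlgebra.ι ℝ (b.dualBasis i) * ExteriorAlgebra.ι ℝ (b.dualBasis j)))

/-- The 4-form `∗φ = e^{1234}+e^{1256}+e^{1367}+e^{1457}+e^{2357}-e^{2467}+e^{3456}` built out
of a family `f` of seven 1-forms (indexed from 0). -/
def starPhiForm {W : Type*} [AddCommGroup W] [Module ℝ W] (f : Fin 7 → W) :
    ExteriorAlgebra ℝ W :=
  let e : Fin 7 → ExteriorAlgebra ℝ W := fun i => ExteriorAlgebra.ι ℝ (f i)
  e 0 * e 1 * e 2 * e 3 + e 0 * e 1 * e 4 * e 5 + e 0 * e 2 * e 5 * e 6 +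
    e 0 * e 3 * e 4 * e 6 + e 1 * e 2 * e 4 * e 6 - e 1 * e 3 * e 5 * e 6 +
    e 2 * e 3 * e 4 * e 5

/-- The 3-form `φ = e^{127}+e^{347}+e^{567}+e^{135}-e^{146}-e^{236}-e^{245}` built out of a
family `f` of seven 1-forms (indexed from 0). -/
def phiG2Form {W : Type*} [AddCommGroup W] [Module ℝ W] (f : Fin 7 → W) :
    ExteriorAlgebra ℝ W :=
  let e : Fin 7 → ExteriorAlgebra ℝ W := fun i => ExteriorAlgebra.ι ℝ (f i)
  e 0 * e 1 * e 6 + e 2 * e 3 * e 6 + e 4 * e 5 * e 6 + e 0 * e 2 * e 4 -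
    e 0 * e 3 * e 5 - e 1 * e 2 * e 5 - e 1 * e 3 * e 4

/-- A 7-dimensional real Lie algebra admits a coclosed G₂-structure if there is a basis
`f¹,…,f⁷` of `g*` for which the 4-form `∗φ` is closed for the Chevalley–Eilenberg
differential. -/
def AdmitsCoclosedG2 (g : Type*) [LieRing g] [LieAlgebra ℝ g] : Prop :=
  ∃ (b : Basis (Fin 7) ℝ g)
    (d : ExteriorAlgebra ℝ (Dual ℝ g) →ₗ[ℝ] ExteriorAlgebra ℝ (Dual ℝ g)),
    IsCEDifferential b d ∧
    ∃ f : Basis (Fin 7) ℝ (Dual ℝ g), d (starPhiForm fun i => f i) = 0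

/-- A 7-dimensional real Lie algebra admits a purely coclosed G₂-structure if there is a basis
`f¹,…,f⁷` of `g*` for which `∗φ` is closed and moreover `φ ∧ dφ = 0`. -/
def AdmitsPurelyCoclosedG2 (g : Type*) [LieRing g] [LieAlgebra ℝ g] : Prop :=
  ∃ (b : Basis (Fin 7) ℝ g)
    (d : ExteriorAlgebra ℝ (Dual ℝ g) →ₗ[ℝ] ExteriorAlgebra ℝ (Dual ℝ g)),
    IsCEDifferential b d ∧
    ∃ f : Basis (Fin 7) ℝ (Dual ℝ g),
      d (starPhiForm fun i => f i) = 0 ∧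
      (phiG2Form fun i => f i) * d (phiG2Form fun i => f i) = 0

/-- A Lie algebra is decomposable if it is the direct sum of two nonzero ideals. -/
def Decomposable (g : Type*) [LieRing g] [LieAlgebra ℝ g] : Prop :=
  ∃ I J : LieIdeal ℝ g, I ≠ ⊥ ∧ J ≠ ⊥ ∧ I ⊓ J = ⊥ ∧ I ⊔ J = ⊤

/-- Shorthand for the 1-form `eⁱ` (the `i`-th dual basis vector) in `Λ g*`. -/
def ef {g : Type*} [LieRing g] [LieAlgebra ℝ g] (b : Basis (Fin 7) ℝ g) (i : Fin 7) :
    ExteriorAlgebra ℝ (Dual ℝ g) :=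
  ExteriorAlgebra.ι ℝ (b.dualBasis i)

/-- The interior product with `X : V` on `Λ V*`. -/
def interiorProduct {V : Type*} [AddCommGroup V] [Module ℝ V] (X : V) :
    ExteriorAlgebra ℝ (Dual ℝ V) →ₗ[ℝ] ExteriorAlgebra ℝ (Dual ℝ V) :=
  CliffordAlgebra.contractLeft (Dual.eval ℝ V X)

section Interior

variable {V : Type*} [AddCommGroup V] [Module ℝ V]

lemma interiorProduct_one (X : V) : interiorProduct X (1 : ExteriorAlgebra ℝ (Dual ℝ V)) = 0 :=
  CliffordAlgebra.contractLeft_one (Q := 0) _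

lemma interiorProduct_ι (X : V) (a : Dual ℝ V) :
    interiorProduct X (ExteriorAlgebra.ι ℝ a) = algebraMap ℝ _ (a X) :=
  CliffordAlgebra.contractLeft_ι (Q := 0) _ _

lemma interiorProduct_ι_mul (X : V) (a : Dual ℝ V) (x : ExteriorAlgebra ℝ (Dual ℝ V)) :
    interiorProduct X (ExteriorAlgebra.ι ℝ a * x) =
      a X • x - ExteriorAlgebra.ι ℝ a * interiorProduct X x :=
  CliffordAlgebra.contractLeft_ι_mul (Q := 0) _ _ _

lemma interiorProduct_self (X : V) (x : ExteriorAlgebra ℝ (Dual ℝ V)) :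
    interiorProduct X (interiorProduct X x) = 0 :=
  CliffordAlgebra.contractLeft_contractLeft (Q := 0) _ _

lemma interiorProduct_comm (X Y : V) (x : ExteriorAlgebra ℝ (Dual ℝ V)) :
    interiorProduct X (interiorProduct Y x) = -interiorProduct Y (interiorProduct X x) :=
  CliffordAlgebra.contractLeft_comm (Q := 0) _ _ _

lemma algebraMapInv_ι_mul (a : Dual ℝ V) (x : ExteriorAlgebra ℝ (Dual ℝ V)) :
    algebraMapInv (ExteriorAlgebra.ι ℝ a * x) = 0 := by
  simp [algebraMapInv]

/-- The value of the degree-two part of `x` on the pair `(u, v)`. -/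
def pairing (x : ExteriorAlgebra ℝ (Dual ℝ V)) : V →ₗ[ℝ] V →ₗ[ℝ] ℝ :=
  LinearMap.mk₂ ℝ (fun u v => algebraMapInv (interiorProduct v (interiorProduct u x)))
    (by intros; simp [interiorProduct]) (by intros; simp [interiorProduct])
    (by intros; simp [interiorProduct]) (by intros; simp [interiorProduct])

lemma pairing_apply (x : ExteriorAlgebra ℝ (Dual ℝ V)) (u v : V) :
    pairing x u v = algebraMapInv (interiorProduct v (interiorProduct u x)) := rfl

lemma pairing_self (x : ExteriorAlgebra ℝ (Dual ℝ V)) (u : V) : pairing x u u = 0 := by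
  simp [pairing_apply, interiorProduct_self]

lemma pairing_swap (x : ExteriorAlgebra ℝ (Dual ℝ V)) (u v : V) :
    pairing x v u = -pairing x u v := by
  rw [pairing_apply, interiorProduct_comm, map_neg, pairing_apply]

/-- The value of `a ∧ b ∧ x` on four vectors, as a sum over shuffles. -/
lemma pairing_interiorProduct_ι_mul_ι_mul (a b : Dual ℝ V) (x : ExteriorAlgebra ℝ (Dual ℝ V))
    (p q r s : V) :
    pairing (interiorProduct q (interiorProduct p
      (ExteriorAlgebra.ι ℝ a * (ExteriorAlgebra.ι ℝ b * x)))) r s =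
      (a p * b q - a q * b p) * pairing x r s - (a p * b r - a r * b p) * pairing x q s +
      (a p * b s - a s * b p) * pairing x q r + (a q * b r - a r * b q) * pairing x p s -
      (a q * b s - a s * b q) * pairing x p r + (a r * b s - a s * b r) * pairing x p q := by
  simp only [pairing_apply, interiorProduct_ι_mul, map_sub, map_smul, algebraMapInv_ι_mul,
    smul_eq_mul, mul_sub, mul_smul_comm, sub_zero, mul_zero]
  ring

lemma pairing_ι_mul_ι (a b : Dual ℝ V) (p q : V) :
    pairing (ExteriorAlgebra.ι ℝ a * ExteriorAlgebra.ι ℝ b) p q = a p * b q - a q * b p := by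
  simp only [pairing_apply, interiorProduct_ι_mul, interiorProduct_ι, map_sub,
    map_smul, smul_eq_mul, ← Algebra.commutes, ← Algebra.smul_def,
    algebraMap_leftInverse (M := Dual ℝ V) _]
  ring

end Interior

/-- The Chevalley–Eilenberg differential of `27A` written with interior products. -/
lemma differential_eq
    (b : Basis (Fin 7) ℝ g)
    (d : ExteriorAlgebra ℝ (Dual ℝ g) →ₗ[ℝ] ExteriorAlgebra ℝ (Dual ℝ g))
    (hd : IsCEDifferential b d)
    (hzero : ∀ i : Fin 7, i ≤ 4 → d (ef b i) = 0)
    (h6 : d (ef b 5) = ef b 0 * ef b 1)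
    (h7 : d (ef b 6) = ef b 0 * ef b 3 + ef b 2 * ef b 4)
    (x : ExteriorAlgebra ℝ (Dual ℝ g)) :
    d x = ef b 0 * (ef b 1 * interiorProduct (b 5) x) +
      (ef b 0 * (ef b 3 * interiorProduct (b 6) x) +
        ef b 2 * (ef b 4 * interiorProduct (b 6) x)) := by
  have hone : d 1 = 0 := by
    have h := hd.2.1 0 1 (by simp [degPart]) 1
    simpa using h
  have hι (a : Dual ℝ g) : d (ExteriorAlgebra.ι ℝ a) = a (b 5) • (ef b 0 * ef b 1) +
      a (b 6) • (ef b 0 * ef b 3 + ef b 2 * ef b 4) := by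
    have ha : ExteriorAlgebra.ι ℝ a = ∑ i, a (b i) • ef b i := by
      have h := congrArg (ExteriorAlgebra.ι ℝ) (b.sum_dual_apply_smul_coord a).symm
      rw [map_sum, ← b.coe_dualBasis] at h
      exact h.trans (Finset.sum_congr rfl fun i _ => map_smul _ _ _)
    rw [ha, map_sum, Fin.sum_univ_seven]
    simp only [map_smul, h6, h7]
    rw [hzero 0 (by decide), hzero 1 (by decide), hzero 2 (by decide), hzero 3 (by decide),
      hzero 4 (by decide)]
    simp
  have hcomm (a p q : Dual ℝ g) (y : ExteriorAlgebra ℝ (Dual ℝ g)) :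
      ExteriorAlgebra.ι ℝ p * (ExteriorAlgebra.ι ℝ q * (ExteriorAlgebra.ι ℝ a * y)) =
        ExteriorAlgebra.ι ℝ a * (ExteriorAlgebra.ι ℝ p * (ExteriorAlgebra.ι ℝ q * y)) := by
    have hswap (u v : Dual ℝ g) : ExteriorAlgebra.ι ℝ u * ExteriorAlgebra.ι ℝ v =
        -(ExteriorAlgebra.ι ℝ v * ExteriorAlgebra.ι ℝ u) :=
      eq_neg_of_add_eq_zero_left (ExteriorAlgebra.ι_add_mul_swap u v)
    rw [← mul_assoc (ExteriorAlgebra.ι ℝ q), hswap q a, neg_mul, mul_neg, ← mul_assoc,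
      ← mul_assoc, hswap p a]
    noncomm_ring
  induction x using CliffordAlgebra.left_induction with
  | algebraMap r =>
    simp [Algebra.algebraMap_eq_smul_one, hone, interiorProduct_one]
  | add x y hx hy =>
    simp only [map_add, hx, hy, mul_add]
    abel
  | ι_mul x a hx =>
    change d (ExteriorAlgebra.ι ℝ a * x) =
      ef b 0 * (ef b 1 * interiorProduct (b 5) (ExteriorAlgebra.ι ℝ a * x)) +
      (ef b 0 * (ef b 3 * interiorProduct (b 6) (ExteriorAlgebra.ι ℝ a * x)) +
        ef b 2 * (ef b 4 * interiorProduct (b 6) (ExteriorAlgebra.ι ℝ a * x)))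
    rw [hd.2.1 1 _ (by simp [degPart]), hι, hx, interiorProduct_ι_mul, interiorProduct_ι_mul]
    simp only [ef, mul_sub, hcomm, mul_smul_comm, add_mul, smul_mul_assoc, mul_add, smul_add,
      mul_assoc, pow_one, neg_smul, one_smul]
    abel

section StarPhi

variable {V : Type*} [AddCommGroup V] [Module ℝ V]

lemma pairing_interiorProduct_ι_mul₄ (a b c e : Dual ℝ V) (p q r s : V) :
    pairing (interiorProduct q (interiorProduct p (ExteriorAlgebra.ι ℝ a * ExteriorAlgebra.ι ℝ b *
      ExteriorAlgebra.ι ℝ c * ExteriorAlgebra.ι ℝ e))) r s =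
      (a p * b q - a q * b p) * (c r * e s - c s * e r) -
      (a p * b r - a r * b p) * (c q * e s - c s * e q) +
      (a p * b s - a s * b p) * (c q * e r - c r * e q) +
      (a q * b r - a r * b q) * (c p * e s - c s * e p) -
      (a q * b s - a s * b q) * (c p * e r - c r * e p) +
      (a r * b s - a s * b r) * (c p * e q - c q * e p) := by
  simp only [mul_assoc (ExteriorAlgebra.ι ℝ a), mul_assoc (ExteriorAlgebra.ι ℝ b),
    pairing_interiorProduct_ι_mul_ι_mul, pairing_ι_mul_ι]

lemma pairing_add (x y : ExteriorAlgebra ℝ (Dual ℝ V)) (u w : V) :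
    pairing (x + y) u w = pairing x u w + pairing y u w := by
  simp [pairing_apply]

lemma pairing_sub (x y : ExteriorAlgebra ℝ (Dual ℝ V)) (u w : V) :
    pairing (x - y) u w = pairing x u w - pairing y u w := by
  simp [pairing_apply]

/-- If the 2-form `ι_Y ι_X ∗φ` squares to zero, then `X` and `Y` have proportional coordinates. -/
lemma mul_eq_mul_of_pfaffian_eq_zero (f : Fin 7 → Dual ℝ V) (v : Fin 7 → V)
    (hfv : ∀ i j, f i (v j) = if i = j then 1 else 0) (X Y : V)
    (hA : ∀ r s t w : V,
      let A := pairing (interiorProduct Y (interiorProduct X (starPhiForm f)))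
      A r s * A t w - A r t * A s w + A r w * A s t = 0) (i j : Fin 7) :
    f i X * f j Y = f j X * f i Y := by
  set A : Fin 7 → Fin 7 → ℝ := fun k l =>
    pairing (interiorProduct Y (interiorProduct X (starPhiForm f))) (v k) (v l) with hAdef
  have hA (k l m n : Fin 7) : A k l * A m n - A k m * A l n + A k n * A l m = 0 :=
    hA (v k) (v l) (v m) (v n)
  set x : Fin 7 → ℝ := fun k => f k X with hx
  set y : Fin 7 → ℝ := fun k => f k Y with hy
  have hval := fun k l : Fin 7 => show A k l = _ by
    simp only [hAdef, starPhiForm, map_add, map_sub, pairing_add, pairing_sub,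
      pairing_interiorProduct_ι_mul₄, hfv]
    exact rfl
  have h01 : A 0 1 = (x 2 * y 3 - x 3 * y 2) + (x 4 * y 5 - x 5 * y 4) := by
    rw [hval]; simp [hx, hy]; ring
  have h02 : A 0 2 = -(x 1 * y 3 - x 3 * y 1) + (x 5 * y 6 - x 6 * y 5) := by
    rw [hval]; simp [hx, hy]; ring
  have h03 : A 0 3 = (x 1 * y 2 - x 2 * y 1) + (x 4 * y 6 - x 6 * y 4) := by
    rw [hval]; simp [hx, hy]; ring
  have h04 : A 0 4 = -(x 1 * y 5 - x 5 * y 1) - (x 3 * y 6 - x 6 * y 3) := by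
    rw [hval]; simp [hx, hy]; ring
  have h05 : A 0 5 = (x 1 * y 4 - x 4 * y 1) - (x 2 * y 6 - x 6 * y 2) := by
    rw [hval]; simp [hx, hy]; ring
  have h06 : A 0 6 = (x 2 * y 5 - x 5 * y 2) + (x 3 * y 4 - x 4 * y 3) := by
    rw [hval]; simp [hx, hy]; ring
  have h12 : A 1 2 = (x 0 * y 3 - x 3 * y 0) + (x 4 * y 6 - x 6 * y 4) := by
    rw [hval]; simp [hx, hy]; ring
  have h13 : A 1 3 = -(x 0 * y 2 - x 2 * y 0) - (x 5 * y 6 - x 6 * y 5) := by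
    rw [hval]; simp [hx, hy]; ring
  have h14 : A 1 4 = (x 0 * y 5 - x 5 * y 0) - (x 2 * y 6 - x 6 * y 2) := by
    rw [hval]; simp [hx, hy]; ring
  have h15 : A 1 5 = -(x 0 * y 4 - x 4 * y 0) + (x 3 * y 6 - x 6 * y 3) := by
    rw [hval]; simp [hx, hy]; ring
  have h16 : A 1 6 = (x 2 * y 4 - x 4 * y 2) - (x 3 * y 5 - x 5 * y 3) := by
    rw [hval]; simp [hx, hy]; ring
  have h23 : A 2 3 = (x 0 * y 1 - x 1 * y 0) + (x 4 * y 5 - x 5 * y 4) := by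
    rw [hval]; simp [hx, hy]; ring
  have h24 : A 2 4 = (x 1 * y 6 - x 6 * y 1) - (x 3 * y 5 - x 5 * y 3) := by
    rw [hval]; simp [hx, hy]; ring
  have h25 : A 2 5 = (x 0 * y 6 - x 6 * y 0) + (x 3 * y 4 - x 4 * y 3) := by
    rw [hval]; simp [hx, hy]; ring
  have h26 : A 2 6 = -(x 0 * y 5 - x 5 * y 0) - (x 1 * y 4 - x 4 * y 1) := by
    rw [hval]; simp [hx, hy]; ring
  have h34 : A 3 4 = (x 0 * y 6 - x 6 * y 0) + (x 2 * y 5 - x 5 * y 2) := by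
    rw [hval]; simp [hx, hy]; ring
  have h35 : A 3 5 = -(x 1 * y 6 - x 6 * y 1) - (x 2 * y 4 - x 4 * y 2) := by
    rw [hval]; simp [hx, hy]; ring
  have h36 : A 3 6 = -(x 0 * y 4 - x 4 * y 0) + (x 1 * y 5 - x 5 * y 1) := by
    rw [hval]; simp [hx, hy]; ring
  have h45 : A 4 5 = (x 0 * y 1 - x 1 * y 0) + (x 2 * y 3 - x 3 * y 2) := by
    rw [hval]; simp [hx, hy]; ring
  have h46 : A 4 6 = (x 0 * y 3 - x 3 * y 0) + (x 1 * y 2 - x 2 * y 1) := by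
    rw [hval]; simp [hx, hy]; ring
  have h56 : A 5 6 = (x 0 * y 2 - x 2 * y 0) - (x 1 * y 3 - x 3 * y 1) := by
    rw [hval]; simp [hx, hy]; ring
  have key : (A 0 1 * A 2 3 - A 0 2 * A 1 3 + A 0 3 * A 1 2)
      + (A 0 1 * A 4 5 - A 0 4 * A 1 5 + A 0 5 * A 1 4)
      + (A 0 2 * A 5 6 - A 0 5 * A 2 6 + A 0 6 * A 2 5)
      + (A 0 3 * A 4 6 - A 0 4 * A 3 6 + A 0 6 * A 3 4)
      + (A 1 2 * A 4 6 - A 1 4 * A 2 6 + A 1 6 * A 2 4)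
      - (A 1 3 * A 5 6 - A 1 5 * A 3 6 + A 1 6 * A 3 5)
      + (A 2 3 * A 4 5 - A 2 4 * A 3 5 + A 2 5 * A 3 4) =
      (∑ k, x k ^ 2) * (∑ k, y k ^ 2) - (∑ k, x k * y k) ^ 2 := by
    simp only [h01, h02, h03, h04, h05, h06, h12, h13, h14, h15, h16, h23,
      h24, h25, h26, h34, h35, h36, h45, h46, h56, Fin.sum_univ_seven]
    ring
  have hzero : (∑ k, x k ^ 2) * (∑ k, y k ^ 2) - (∑ k, x k * y k) ^ 2 = 0 := by
    rw [← key, hA 0 1 2 3, hA 0 1 4 5, hA 0 2 5 6, hA 0 3 4 6, hA 1 2 4 6, hA 1 3 5 6, hA 2 3 4 5]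
    norm_num
  have hlag : ∑ k, ∑ l, (x k * y l - x l * y k) ^ 2 = 0 := by
    have h : ∑ k, ∑ l, (x k * y l - x l * y k) ^ 2 =
        2 * ((∑ k, x k ^ 2) * (∑ k, y k ^ 2) - (∑ k, x k * y k) ^ 2) := by
      simp only [Fin.sum_univ_seven]
      ring
    rw [h, hzero, mul_zero]
  have h1 := (Finset.sum_eq_zero_iff_of_nonneg fun k _ =>
    Finset.sum_nonneg fun l _ => sq_nonneg (x k * y l - x l * y k)).1 hlag i (Finset.mem_univ i)
  have h2 := (Finset.sum_eq_zero_iff_of_nonneg fun l _ =>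
    sq_nonneg (x i * y l - x l * y i)).1 h1 j (Finset.mem_univ j)
  exact sub_eq_zero.1 (pow_eq_zero_iff two_ne_zero |>.1 h2)

end StarPhi

lemma dualBasis_apply_self (b : Basis (Fin 7) ℝ g) (i j : Fin 7) :
    b.dualBasis i (b j) = if i = j then 1 else 0 := by
  rw [b.coe_dualBasis, b.coord_apply, b.repr_self, Finsupp.single_apply]
  simp only [eq_comm]

/-- If `ι_{e₇} ι_{e₆} ψ` is annihilated by `e^{12}` and `e^{14} + e^{35}`, then it squares to
zero. -/
lemma pfaffian_eq_zero (b : Basis (Fin 7) ℝ g) (x : ExteriorAlgebra ℝ (Dual ℝ g))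
    (h₅ : interiorProduct (b 5) x = 0) (h₆ : interiorProduct (b 6) x = 0)
    (h₁ : ef b 0 * (ef b 1 * x) = 0)
    (h₂ : ef b 0 * (ef b 3 * x) + ef b 2 * (ef b 4 * x) = 0) (r s t w : g) :
    pairing x r s * pairing x t w - pairing x r t * pairing x s w +
      pairing x r w * pairing x s t = 0 := by
  have hx₅ (u : g) : pairing x (b 5) u = 0 := by simp [pairing_apply, h₅]
  have hx₆ (u : g) : pairing x (b 6) u = 0 := by simp [pairing_apply, h₆]
  have hself := pairing_self x
  have e₁ (i j k l : Fin 7) := congrArg (fun z => pairing (interiorProduct (b j)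
    (interiorProduct (b i) z)) (b k) (b l)) h₁
  have e₂ (i j k l : Fin 7) := congrArg (fun z => pairing (interiorProduct (b j)
    (interiorProduct (b i) z)) (b k) (b l)) h₂
  have hpair0 (u w : g) : pairing (0 : ExteriorAlgebra ℝ (Dual ℝ g)) u w = 0 := by
    simp [pairing_apply]
  simp only [ef, map_add, pairing_add, pairing_interiorProduct_ι_mul_ι_mul, dualBasis_apply_self,
    map_zero, hpair0] at e₁ e₂
  have h23 : pairing x (b 2) (b 3) = 0 := by simpa using e₁ 0 1 2 3
  have h24 : pairing x (b 2) (b 4) = 0 := by simpa using e₁ 0 1 2 4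
  have h34 : pairing x (b 3) (b 4) = 0 := by simpa using e₁ 0 1 3 4
  have h01 : pairing x (b 0) (b 1) = 0 := by simpa using e₂ 2 4 0 1
  have h03 : pairing x (b 0) (b 3) = 0 := by simpa [h24] using e₂ 2 4 0 3
  have h12 : pairing x (b 1) (b 2) = 0 := by simpa using e₂ 0 3 1 2
  have h14 : pairing x (b 1) (b 4) = 0 := by simpa using e₂ 0 3 1 4
  have h13 : pairing x (b 1) (b 3) = 0 := by simpa using e₂ 2 4 1 3
  have hswap (i j : Fin 7) := pairing_swap x (b i) (b j)
  have hA (u v : g) : pairing x u v =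
      pairing x (b 0) (b 2) * (b.repr u 0 * b.repr v 2 - b.repr u 2 * b.repr v 0) +
      pairing x (b 0) (b 4) * (b.repr u 0 * b.repr v 4 - b.repr u 4 * b.repr v 0) := by
    conv_lhs => rw [← b.sum_repr u, ← b.sum_repr v]
    have hr₅ (u : g) : pairing x u (b 5) = 0 := by rw [pairing_swap, hx₅, neg_zero]
    have hr₆ (u : g) : pairing x u (b 6) = 0 := by rw [pairing_swap, hx₆, neg_zero]
    simp only [Fin.sum_univ_seven, map_add, map_smul, LinearMap.add_apply, LinearMap.smul_apply,
      hx₅, hx₆, hr₅, hr₆, hself, h01, h03, h12, h13, h14, h23, h24, h34, hswap 0 1, hswap 0 2,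
      hswap 0 3, hswap 0 4, hswap 1 2, hswap 1 3, hswap 1 4, hswap 2 3, hswap 2 4, hswap 3 4,
      smul_eq_mul]
    ring
  rw [hA r s, hA t w, hA r t, hA s w, hA r w, hA s t]
  ring

/-- The Lie algebra `27A` (`de⁶ = e^{12}`, `de⁷ = e^{14} + e^{35}`, all other
`deⁱ = 0`) does not admit a coclosed G₂-structure: for every basis `f¹,…,f⁷` of its dual space,
the 4-form `∗φ` is not `d`-closed. -/
theorem lie27A_no_coclosed
    (b : Basis (Fin 7) ℝ g)
    (d : ExteriorAlgebra ℝ (Dual ℝ g) →ₗ[ℝ] ExteriorAlgebra ℝ (Dual ℝ g))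
    (hd : IsCEDifferential b d)
    (hzero : ∀ i : Fin 7, i ≤ 4 → d (ef b i) = 0)
    (h6 : d (ef b 5) = ef b 0 * ef b 1)
    (h7 : d (ef b 6) = ef b 0 * ef b 3 + ef b 2 * ef b 4) :
    ∀ f : Basis (Fin 7) ℝ (Dual ℝ g), d (starPhiForm fun i => f i) ≠ 0 := by
  intro f h
  set ψ := starPhiForm fun i => f i
  set x := interiorProduct (b 6) (interiorProduct (b 5) ψ) with hx
  rw [differential_eq b d hd hzero h6 h7] at h
  have h₁ := congrArg (interiorProduct (b 6)) h
  have h₂ := congrArg (interiorProduct (b 5)) h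
  simp only [ef, map_add, interiorProduct_ι_mul, dualBasis_apply_self, interiorProduct_self,
    map_zero] at h₁ h₂
  rw [interiorProduct_comm (b 5) (b 6)] at h₂
  have hpf := pfaffian_eq_zero b x
    (by rw [hx, interiorProduct_comm, interiorProduct_self, map_zero, neg_zero])
    (by rw [hx, interiorProduct_self])
    (by simpa [ef, hx] using h₁)
    (by simpa [ef, hx, ← neg_add, -neg_add_rev] using h₂)
  have : Module.Finite ℝ g := Module.Finite.of_basis b
  have hprop := mul_eq_mul_of_pfaffian_eq_zero (fun i => f i)
    (fun i => (Module.evalEquiv ℝ g).symm (f.dualBasis i))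
    (fun i j => by simp [Finsupp.single_apply]) (b 5) (b 6) hpf
  have hcomb (j : Fin 7) : f j (b 6) • b 5 - f j (b 5) • b 6 = 0 := by
    rw [← Module.forall_dual_apply_eq_zero_iff ℝ]
    have hev : Dual.eval ℝ g (f j (b 6) • b 5 - f j (b 5) • b 6) = 0 := by
      refine f.ext fun i => ?_
      rw [Dual.eval_apply, map_sub, map_smul, map_smul, smul_eq_mul, smul_eq_mul,
        LinearMap.zero_apply]
      linarith [hprop i j]
    exact fun a => LinearMap.congr_fun hev a
  have hf (j : Fin 7) : f j (b 6) = 0 := by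
    simpa [dualBasis_apply_self, -Basis.coe_dualBasis] using congrArg (b.dualBasis 5) (hcomb j)
  have hev : Dual.eval ℝ g (b 6) = 0 := f.ext fun j => hf j
  exact b.ne_zero 6 ((Module.forall_dual_apply_eq_zero_iff ℝ _).1 fun a =>
    LinearMap.congr_fun hev a)
end
end

section
/- The 7-dimensional indecomposable 3-step nilpotent Lie algebra 357B, with basis e₁,…,e₇ and structure equations de³ = e^{12}, de⁵ = e^{13}, de⁶ = e^{23}, de⁷ = e^{14} (all other de^i = 0), does not admit a coclosed G2-structure: for every basis f¹,…,f⁷ of its dual space, the 4-form ∗φ = f^{1234}+f^{1256}+f^{1367}+f^{1457}+f^{2357}−f^{2467}+f^{3456} is not d-closed. (Part of Theorem '3step-indecomposable-pure' of the paper.) -/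
set_option synthInstance.maxHeartbeats 1000000
set_option maxHeartbeats 1000000

open ExteriorAlgebra Module

noncomputable section

variable {g : Type*} [LieRing g] [LieAlgebra ℝ g]

/-- The linear functional on the exterior algebra which reads off the coefficient of
`f 0 ∧ ⋯ ∧ f (n - 1)` in the degree-`n` part. -/
def topCoeff {W : Type*} [AddCommGroup W] [Module ℝ W] {n : ℕ} (f : Basis (Fin n) ℝ W) :
    ExteriorAlgebra ℝ W →ₗ[ℝ] ℝ :=
  liftAlternating (Pi.single n f.det)

section

variable {W : Type*} [AddCommGroup W] [Module ℝ W]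

theorem topCoeff_ofFn {n : ℕ} (f : Basis (Fin n) ℝ W) (v : Fin n → W) :
    topCoeff f (List.ofFn fun i => ExteriorAlgebra.ι ℝ (v i)).prod = f.det v := by
  rw [← ιMulti_apply, topCoeff, liftAlternating_apply_ιMulti, Pi.single_eq_same]

theorem topCoeff_list_eq_zero {n : ℕ} {κ : Type*} (f : Basis (Fin n) ℝ W) (e : κ → W)
    (l : List κ) (hl : l.length = n) (hd : ¬ l.Nodup) :
    topCoeff f (l.map fun i => ExteriorAlgebra.ι ℝ (e i)).prod = 0 := by
  subst hl
  have h : (l.map fun i => ExteriorAlgebra.ι ℝ (e i)) =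
      List.ofFn fun i : Fin l.length => ExteriorAlgebra.ι ℝ (e (l.get i)) := by
    conv_lhs => rw [← List.ofFn_get l]
    rw [List.map_ofFn]
    rfl
  rw [h, topCoeff_ofFn f fun i => e (l.get i)]
  refine AlternatingMap.map_eq_zero_of_not_injective _ _ fun hi => hd ?_
  exact List.nodup_iff_injective_get.2 (Function.Injective.of_comp hi)

theorem ι_mem_degPart (x : W) : ExteriorAlgebra.ι ℝ x ∈ degPart W 1 := by
  rw [degPart, pow_one]
  exact LinearMap.mem_range_self _ _

/-- An odd derivation of the exterior algebra which sends each vector of a basis either to zero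
or to the product of two other basis vectors kills the forms of degree one below the top. -/
theorem topCoeff_derivation_eq_zero {n : ℕ} (f e : Basis (Fin (n + 1)) ℝ W)
    (d : ExteriorAlgebra ℝ W →ₗ[ℝ] ExteriorAlgebra ℝ W)
    (hd : ∀ k, ∀ x ∈ degPart W k, ∀ y, d (x * y) = d x * y + ((-1 : ℝ)) ^ k • (x * d y))
    (he : ∀ a, d (ExteriorAlgebra.ι ℝ (e a)) = 0 ∨ ∃ p q, p ≠ a ∧ q ≠ a ∧
      d (ExteriorAlgebra.ι ℝ (e a)) = ExteriorAlgebra.ι ℝ (e p) * ExteriorAlgebra.ι ℝ (e q))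
    (v : Fin n → W) :
    topCoeff f (d (List.ofFn fun i => ExteriorAlgebra.ι ℝ (v i)).prod) = 0 := by
  have d_one : d 1 = 0 := by
    have h := hd 0 1 (by rw [degPart, pow_zero]; exact Submodule.one_le.1 le_rfl) 1
    simpa using h
  have aux : ∀ t s : List (Fin (n + 1)), (s ++ t).Nodup → (s ++ t).length = n →
      topCoeff f ((s.map fun i => ExteriorAlgebra.ι ℝ (e i)).prod *
        d (t.map fun i => ExteriorAlgebra.ι ℝ (e i)).prod) = 0 := by
    intro t
    induction t with
    | nil => intro s _ _; simp [d_one]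
    | cons a t ih =>
      intro s hs hl
      have ih' := ih (s ++ [a]) (by simpa using hs) (by simpa using hl)
      have h1 : topCoeff f ((s.map fun i => ExteriorAlgebra.ι ℝ (e i)).prod *
          (d (ExteriorAlgebra.ι ℝ (e a)) *
            (t.map fun i => ExteriorAlgebra.ι ℝ (e i)).prod)) = 0 := by
        rcases he a with h0 | ⟨p, q, hp, hq, hpq⟩
        · simp [h0]
        · have hlen : (s ++ p :: q :: t).length = n + 1 := by
            simp only [List.length_append, List.length_cons] at hl ⊢
            omega
          have key := topCoeff_list_eq_zero f e (s ++ p :: q :: t) hlen (by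
            intro hnd
            have hmem : a ∈ s ++ p :: q :: t := by
              have hu : (s ++ p :: q :: t).toFinset = Finset.univ := by
                rw [← Finset.card_eq_iff_eq_univ, List.toFinset_card_of_nodup hnd, hlen,
                  Fintype.card_fin]
              rw [← List.mem_toFinset, hu]
              exact Finset.mem_univ a
            have hs' := (List.nodup_middle.1 hs)
            rw [List.nodup_cons, List.mem_append] at hs'
            simp only [List.mem_append, List.mem_cons] at hmem
            rcases hmem with h | h | h | h
            · exact hs'.1 (Or.inl h)
            · exact hp h.symm
            · exact hq h.symm
            · exact hs'.1 (Or.inr h))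
          rw [hpq]
          simpa [mul_assoc] using key
      rw [List.map_cons, List.prod_cons, hd 1 _ (ι_mem_degPart _), mul_add, map_add, h1]
      simpa [mul_assoc] using ih'
  have hzero : ((topCoeff f).comp d).compAlternatingMap (ιMulti ℝ n) = 0 := by
    refine Basis.ext_alternating e fun v hv => ?_
    have h := aux (List.ofFn v) [] (by simpa using List.nodup_ofFn.2 hv) (by simp)
    simpa [ιMulti_apply, List.map_ofFn, Function.comp_def] using h
  simpa [ιMulti_apply] using DFunLike.congr_fun hzero v

theorem det_of_last_column {n : ℕ} (M : Matrix (Fin (n + 1)) (Fin (n + 1)) ℝ) (p : Fin (n + 1))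
    (h : ∀ i, M i (Fin.last n) = if p = i then 1 else 0) :
    M.det = (-1) ^ (p + n : ℕ) * (M.submatrix p.succAbove Fin.castSucc).det := by
  rw [Matrix.det_succ_column M (Fin.last n)]
  simp [h]

theorem det_pair (f : Basis (Fin 7) ℝ W) (x y : W)
    (p : Fin 7) (q : Fin 6) (r : Fin 5) (s : Fin 4) (t : Fin 3) :
    f.det ![x, y, f (p.succAbove (q.succAbove (r.succAbove (s.succAbove t)))),
      f (p.succAbove (q.succAbove (r.succAbove s))), f (p.succAbove (q.succAbove r)),
      f (p.succAbove q), f p] =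
    (-1) ^ (p + q + r + s + t : ℕ) *
      (f.repr x (p.succAbove (q.succAbove (r.succAbove (s.succAbove (t.succAbove 0))))) *
        f.repr y (p.succAbove (q.succAbove (r.succAbove (s.succAbove (t.succAbove 1))))) -
      f.repr x (p.succAbove (q.succAbove (r.succAbove (s.succAbove (t.succAbove 1))))) *
        f.repr y (p.succAbove (q.succAbove (r.succAbove (s.succAbove (t.succAbove 0)))))) := by
  rw [Basis.det_apply, det_of_last_column _ p, det_of_last_column _ q, det_of_last_column _ r,
    det_of_last_column _ s, det_of_last_column _ t, Matrix.det_fin_two]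
  · simp [Basis.toMatrix_apply]
    ring
  all_goals
    intro i
    simp [Basis.toMatrix_apply, Finsupp.single_apply]

theorem det_pair_eq_zero (f : Basis (Fin 7) ℝ W) (x y : W)
    (i : Fin 5 → Fin 7) (h : ¬ Function.Injective i) :
    f.det ![x, y, f (i 0), f (i 1), f (i 2), f (i 3), f (i 4)] = 0 := by
  refine AlternatingMap.map_eq_zero_of_not_injective _ _ fun hi => h fun j k hjk => ?_
  have hv : ∀ j : Fin 5, (![x, y, f (i 0), f (i 1), f (i 2), f (i 3), f (i 4)] : Fin 7 → W)
      (Fin.natAdd 2 j) = f (i j) := by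
    intro j
    fin_cases j <;> rfl
  exact (Fin.natAdd_inj 2).1 (hi (by rw [hv, hv, hjk]))

/-- If the `G₂` cross product of two vectors of `ℝ⁷` vanishes, so do the `2 × 2` minors `m p q`
of these vectors. -/
theorem minors_eq_zero_of_cross_eq_zero (a c : Fin 7 → ℝ) (m : Fin 7 → Fin 7 → ℝ)
    (hm : ∀ p q, m p q = a p * c q - a q * c p)
    (h0 : m 2 4 + m 1 6 - m 3 5 = 0) (h1 : m 0 6 + m 3 4 + m 2 5 = 0)
    (h2 : m 3 6 + m 1 5 - m 0 4 = 0) (h3 : m 1 4 + m 0 5 - m 2 6 = 0)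
    (h4 : m 5 6 + m 0 2 - m 1 3 = 0) (h5 : m 4 6 + m 1 2 + m 0 3 = 0)
    (h6 : m 4 5 + m 2 3 + m 0 1 = 0) (p q : Fin 7) : m p q = 0 := by
  have key : ∑ p, ∑ q, m p q ^ 2 =
      2 * ((m 2 4 + m 1 6 - m 3 5) ^ 2 + (m 0 6 + m 3 4 + m 2 5) ^ 2 +
      (m 3 6 + m 1 5 - m 0 4) ^ 2 + (m 1 4 + m 0 5 - m 2 6) ^ 2 + (m 5 6 + m 0 2 - m 1 3) ^ 2 +
      (m 4 6 + m 1 2 + m 0 3) ^ 2 + (m 4 5 + m 2 3 + m 0 1) ^ 2) := by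
    simp only [hm, Fin.sum_univ_seven]
    ring
  rw [h0, h1, h2, h3, h4, h5, h6] at key
  have hp : ∀ p, 0 ≤ ∑ q, m p q ^ 2 := fun p => Finset.sum_nonneg fun q _ => sq_nonneg _
  norm_num at key
  rw [Finset.sum_eq_zero_iff_of_nonneg fun p _ => hp p] at key
  have := key p (Finset.mem_univ p)
  rw [Finset.sum_eq_zero_iff_of_nonneg fun q _ => sq_nonneg _] at this
  exact pow_eq_zero_iff two_ne_zero |>.1 (this q (Finset.mem_univ q))

theorem topCoeff_seven (f : Basis (Fin 7) ℝ W) (v₀ v₁ v₂ v₃ v₄ v₅ v₆ : W) :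
    topCoeff f (ExteriorAlgebra.ι ℝ v₀ * ExteriorAlgebra.ι ℝ v₁ * ExteriorAlgebra.ι ℝ v₂ *
      (ExteriorAlgebra.ι ℝ v₃ * ExteriorAlgebra.ι ℝ v₄ * ExteriorAlgebra.ι ℝ v₅ *
        ExteriorAlgebra.ι ℝ v₆)) = f.det ![v₀, v₁, v₂, v₃, v₄, v₅, v₆] := by
  rw [← topCoeff_ofFn]
  simp [List.ofFn_succ, mul_assoc]

/-- The product of two linearly independent 1-forms does not annihilate `∗φ`. -/
theorem minors_eq_zero_of_topCoeff_eq_zero (f : Basis (Fin 7) ℝ W) (x y : W)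
    (h : ∀ k, topCoeff f (ExteriorAlgebra.ι ℝ x * ExteriorAlgebra.ι ℝ y *
      ExteriorAlgebra.ι ℝ (f k) * starPhiForm fun i => f i) = 0) (p q : Fin 7) :
    f.repr x p * f.repr y q - f.repr x q * f.repr y p = 0 := by
  have z : ∀ i₀ i₁ i₂ i₃ i₄ : Fin 7, ¬ [i₀, i₁, i₂, i₃, i₄].Nodup →
      f.det ![x, y, f i₀, f i₁, f i₂, f i₃, f i₄] = 0 := by
    intro i₀ i₁ i₂ i₃ i₄ hi
    exact det_pair_eq_zero f x y ![i₀, i₁, i₂, i₃, i₄] fun hinj => hi (by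
      simpa using List.nodup_ofFn.2 hinj)
  simp only [starPhiForm, mul_add, mul_sub, map_add, map_sub, topCoeff_seven] at h
  refine minors_eq_zero_of_cross_eq_zero (f.repr x) (f.repr y)
    (fun p q => f.repr x p * f.repr y q - f.repr x q * f.repr y p) (fun _ _ => rfl)
    ?_ ?_ ?_ ?_ ?_ ?_ ?_ p q
  · have hk := h 0
    have h₁ := det_pair f x y 6 4 2 1 0
    have h₂ := det_pair f x y 6 5 3 1 0
    have h₃ := det_pair f x y 5 4 3 2 0
    simp [Fin.succAbove] at h₁ h₂ h₃
    simp (disch := decide) only [z, h₁, h₂, h₃] at hk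
    linear_combination (1) * hk
  · have hk := h 1
    have h₁ := det_pair f x y 6 5 2 0 0
    have h₂ := det_pair f x y 6 4 3 0 0
    have h₃ := det_pair f x y 5 4 3 2 1
    simp [Fin.succAbove] at h₁ h₂ h₃
    simp (disch := decide) only [z, h₁, h₂, h₃] at hk
    linear_combination (-1) * hk
  · have hk := h 2
    have h₁ := det_pair f x y 5 4 1 0 0
    have h₂ := det_pair f x y 6 4 3 0 1
    have h₃ := det_pair f x y 6 5 3 1 1
    simp [Fin.succAbove] at h₁ h₂ h₃
    simp (disch := decide) only [z, h₁, h₂, h₃] at hk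
    linear_combination (1) * hk
  · have hk := h 3
    have h₁ := det_pair f x y 5 4 1 0 1
    have h₂ := det_pair f x y 6 5 2 0 1
    have h₃ := det_pair f x y 6 4 2 1 1
    simp [Fin.succAbove] at h₁ h₂ h₃
    simp (disch := decide) only [z, h₁, h₂, h₃] at hk
    linear_combination (1) * hk
  · have hk := h 4
    have h₁ := det_pair f x y 3 2 1 0 0
    have h₂ := det_pair f x y 6 5 2 0 2
    have h₃ := det_pair f x y 6 5 3 1 2
    simp [Fin.succAbove] at h₁ h₂ h₃
    simp (disch := decide) only [z, h₁, h₂, h₃] at hk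
    linear_combination (1) * hk
  · have hk := h 5
    have h₁ := det_pair f x y 3 2 1 0 1
    have h₂ := det_pair f x y 6 4 3 0 2
    have h₃ := det_pair f x y 6 4 2 1 2
    simp [Fin.succAbove] at h₁ h₂ h₃
    simp (disch := decide) only [z, h₁, h₂, h₃] at hk
    linear_combination (-1) * hk
  · have hk := h 6
    have h₁ := det_pair f x y 3 2 1 0 2
    have h₂ := det_pair f x y 5 4 1 0 2
    have h₃ := det_pair f x y 5 4 3 2 2
    simp [Fin.succAbove] at h₁ h₂ h₃
    simp (disch := decide) only [z, h₁, h₂, h₃] at hk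
    linear_combination (1) * hk

end

/-- The Lie algebra `357B` (`de³ = e^{12}`, `de⁵ = e^{13}`, `de⁶ = e^{23}`,
`de⁷ = e^{14}`, all other `deⁱ = 0`) does not admit a coclosed G₂-structure: for every basis
`f¹,…,f⁷` of its dual space, the 4-form `∗φ` is not `d`-closed. -/
theorem lie357B_no_coclosed
    (b : Basis (Fin 7) ℝ g)
    (d : ExteriorAlgebra ℝ (Dual ℝ g) →ₗ[ℝ] ExteriorAlgebra ℝ (Dual ℝ g))
    (hd : IsCEDifferential b d)
    (h1 : d (ef b 0) = 0) (h2 : d (ef b 1) = 0) (h4 : d (ef b 3) = 0)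
    (h3 : d (ef b 2) = ef b 0 * ef b 1)
    (h5 : d (ef b 4) = ef b 0 * ef b 2)
    (h6 : d (ef b 5) = ef b 1 * ef b 2)
    (h7 : d (ef b 6) = ef b 0 * ef b 3) :
    ∀ f : Basis (Fin 7) ℝ (Dual ℝ g), d (starPhiForm fun i => f i) ≠ 0 := by
  intro f hf
  obtain ⟨-, hmul, -⟩ := hd
  have hder : ∀ a, d (ExteriorAlgebra.ι ℝ (b.dualBasis a)) = 0 ∨ ∃ p q, p ≠ a ∧ q ≠ a ∧
      d (ExteriorAlgebra.ι ℝ (b.dualBasis a)) =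
        ExteriorAlgebra.ι ℝ (b.dualBasis p) * ExteriorAlgebra.ι ℝ (b.dualBasis q) := by
    intro a
    fin_cases a
    · exact Or.inl h1
    · exact Or.inl h2
    · exact Or.inr ⟨0, 1, by decide, by decide, h3⟩
    · exact Or.inl h4
    · exact Or.inr ⟨0, 2, by decide, by decide, h5⟩
    · exact Or.inr ⟨1, 2, by decide, by decide, h6⟩
    · exact Or.inr ⟨0, 3, by decide, by decide, h7⟩
  have hsix : ∀ v : Fin 6 → Dual ℝ g,
      topCoeff f (d (List.ofFn fun i => ExteriorAlgebra.ι ℝ (v i)).prod) = 0 :=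
    topCoeff_derivation_eq_zero f b.dualBasis d hmul hder
  have hprod : ∀ x₀ x₁ x₂ x₃ x₄ x₅ : Dual ℝ g,
      topCoeff f (d (ExteriorAlgebra.ι ℝ x₀ * ExteriorAlgebra.ι ℝ x₁ *
        (ExteriorAlgebra.ι ℝ x₂ * ExteriorAlgebra.ι ℝ x₃ * ExteriorAlgebra.ι ℝ x₄ *
          ExteriorAlgebra.ι ℝ x₅))) = 0 := by
    intro x₀ x₁ x₂ x₃ x₄ x₅
    have h := hsix ![x₀, x₁, x₂, x₃, x₄, x₅]
    simpa [List.ofFn_succ, mul_assoc] using h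
  have hpair : ∀ i j : Fin 7,
      topCoeff f ((d (ef b i) * ef b j - ef b i * d (ef b j)) * starPhiForm fun i => f i) = 0 := by
    intro i j
    have hmem : ef b i * ef b j ∈ degPart (Dual ℝ g) 2 := by
      rw [degPart, pow_two]
      exact Submodule.mul_mem_mul (LinearMap.mem_range_self _ _) (LinearMap.mem_range_self _ _)
    have hleib : (d (ef b i) * ef b j - ef b i * d (ef b j)) * (starPhiForm fun i => f i) =
        d (ef b i * ef b j * starPhiForm fun i => f i) := by
      rw [hmul 2 _ hmem, hf, hmul 1 (ef b i) (ι_mem_degPart _)]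
      simp [sub_eq_add_neg]
    rw [hleib]
    simp only [starPhiForm, ef, mul_add, mul_sub, map_add, map_sub, hprod]
    norm_num
  have hsq : ∀ i, ef b i * ef b i = 0 := fun i => ι_sq_zero _
  have hswap : ∀ i j, ef b i * ef b j = -(ef b j * ef b i) := fun i j =>
    eq_neg_of_add_eq_zero_left (ι_add_mul_swap _ _)
  have hann : ∀ i, topCoeff f (ef b 0 * ef b 1 * ef b i * starPhiForm fun i => f i) = 0 := by
    intro i
    fin_cases i
    · have : ef b 0 * ef b 1 * ef b 0 = 0 := by rw [hswap 0 1, neg_mul, mul_assoc, hsq]; simp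
      simp [this]
    · simp [mul_assoc (ef b 0) (ef b 1) (ef b 1), hsq]
    · have h := hpair 0 5
      rw [h1, h6] at h
      simpa [mul_assoc] using h
    · have h := hpair 1 6
      rw [h2, h7, ← mul_assoc, hswap 1 0] at h
      simpa using h
    · have h := hpair 2 4
      rw [h3, h5, ← mul_assoc, hswap 2 0, neg_mul, mul_assoc (ef b 0) (ef b 2), hsq] at h
      simpa using h
    · have h := hpair 2 5
      rw [h3, h6, ← mul_assoc, hswap 2 1, neg_mul, mul_assoc (ef b 1) (ef b 2), hsq] at h
      simpa using h
    · have h := hpair 2 6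
      have h' := hpair 3 4
      rw [h3, h7, ← mul_assoc, hswap 2 0, neg_mul, sub_neg_eq_add, add_mul, map_add] at h
      rw [h4, h5, ← mul_assoc, hswap 3 0, neg_mul, mul_assoc (ef b 0), hswap 3 2] at h'
      simp only [mul_assoc, zero_mul, mul_neg, neg_mul, neg_neg, zero_sub, map_neg] at h h' ⊢
      change topCoeff f (ef b 0 * (ef b 1 * (ef b 6 * _))) = 0
      linear_combination h + h'
  have hall : ∀ γ : Dual ℝ g, topCoeff f (ef b 0 * ef b 1 * ExteriorAlgebra.ι ℝ γ *
      starPhiForm fun i => f i) = 0 := by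
    intro γ
    rw [← b.dualBasis.sum_repr γ]
    simp only [map_sum, map_smul, Finset.mul_sum, Finset.sum_mul, mul_smul_comm, smul_mul_assoc]
    exact Finset.sum_eq_zero fun i _ => by rw [show ExteriorAlgebra.ι ℝ (b.dualBasis i) = ef b i
      from rfl, hann, smul_zero]
  have hminor := minors_eq_zero_of_topCoeff_eq_zero f (b.dualBasis 0) (b.dualBasis 1)
    fun k => hall (f k)
  have hzero : f.repr (b.dualBasis 0) = 0 := by
    ext p
    have hrel : f.repr (b.dualBasis 0) p • b.dualBasis 1 =
        f.repr (b.dualBasis 1) p • b.dualBasis 0 := by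
      refine f.repr.injective (Finsupp.ext fun q => ?_)
      simp only [map_smul, Finsupp.smul_apply, smul_eq_mul]
      linear_combination hminor p q
    have h := congrArg (fun w => b.dualBasis.repr w 1) hrel
    simp only [map_smul, Finsupp.smul_apply, Basis.repr_self] at h
    simpa using h
  exact b.dualBasis.ne_zero 0 (f.repr.map_eq_zero_iff.1 hzero)
end
end
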